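/- For the vertex-cover LP of a graph with n vertices (n ≥ 3) and m edges, written in inequality form Ax ≥ b, x ≥ 0 with ‖d‖ = max(‖A‖_F, ‖b‖₂, ‖c‖₂) = √(2m+n), the product of the reciprocals of the primal and dual condition numbers satisfies 1/(δ_P δ_D) ≤ C · (m + n) n^{1/2} for an absolute constant C (specifically, δ_P ≥ ‖d‖^{-1} n^{-1/2}/4 and δ_D ≥ ‖d‖^{-1}, so 1/(δ_P δ_D) ≤ 4 ‖d‖² n^{1/2} = 4 (2m+n) n^{1/2}). -/

import Mathlib

open Matrix Finset MeasureTheory ProbabilityTheory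

/-- Euclidean norm of a finitely-indexed real vector. -/
noncomputable def l2norm {ι : Type*} [Fintype ι] (x : ι → ℝ) : ℝ :=
  Real.sqrt (∑ i, (x i) ^ 2)

/-- Frobenius norm of a real matrix. -/
noncomputable def frobNorm {ι κ : Type*} [Fintype ι] [Fintype κ] (A : Matrix ι κ ℝ) : ℝ :=
  Real.sqrt (∑ i, ∑ j, (A i j) ^ 2)

/-- Euclidean inner product. -/
noncomputable def rdot {ι : Type*} [Fintype ι] (a b : ι → ℝ) : ℝ := ∑ i, a i * b i

/-- Feasibility of the inequality-form primal LP `Ax ≥ b, x ≥ 0`. -/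
def PrimalFeasibleIneq {ι κ : Type*} [Fintype ι] [Fintype κ]
    (A : Matrix ι κ ℝ) (b : ι → ℝ) : Prop :=
  ∃ x : κ → ℝ, (∀ j, 0 ≤ x j) ∧ ∀ i, b i ≤ A.mulVec x i

/-- Feasibility of the dual `Aᵀy ≤ c, y ≥ 0` of an inequality-form primal LP. -/
def DualFeasibleIneq {ι κ : Type*} [Fintype ι] [Fintype κ]
    (A : Matrix ι κ ℝ) (c : κ → ℝ) : Prop :=
  ∃ y : ι → ℝ, (∀ i, 0 ≤ y i) ∧ ∀ j, Aᵀ.mulVec y j ≤ c j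

/-- Norm of the data `d = (A, b, c)`: `max(‖A‖_F, ‖b‖₂, ‖c‖₂)`. -/
noncomputable def dnorm {ι κ : Type*} [Fintype ι] [Fintype κ]
    (A : Matrix ι κ ℝ) (b : ι → ℝ) (c : κ → ℝ) : ℝ :=
  max (frobNorm A) (max (l2norm b) (l2norm c))

/-- Distance of the data to primal infeasibility (inequality form). -/
noncomputable def distPriIneq {ι κ : Type*} [Fintype ι] [Fintype κ]
    (A : Matrix ι κ ℝ) (b : ι → ℝ) (c : κ → ℝ) : ℝ :=
  sInf { r : ℝ | ∃ (dA : Matrix ι κ ℝ) (db : ι → ℝ) (dc : κ → ℝ),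
    ¬ PrimalFeasibleIneq (A + dA) (b + db) ∧ r = dnorm dA db dc }

/-- Distance of the data to dual infeasibility (inequality form). -/
noncomputable def distDualIneq {ι κ : Type*} [Fintype ι] [Fintype κ]
    (A : Matrix ι κ ℝ) (b : ι → ℝ) (c : κ → ℝ) : ℝ :=
  sInf { r : ℝ | ∃ (dA : Matrix ι κ ℝ) (db : ι → ℝ) (dc : κ → ℝ),
    ¬ DualFeasibleIneq (A + dA) (c + dc) ∧ r = dnorm dA db dc }

/-- Renegar primal condition number `δ_P` (inequality form). -/
noncomputable def deltaPIneq {ι κ : Type*} [Fintype ι] [Fintype κ]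
    (A : Matrix ι κ ℝ) (b : ι → ℝ) (c : κ → ℝ) : ℝ := distPriIneq A b c / dnorm A b c

/-- Renegar dual condition number `δ_D` (inequality form). -/
noncomputable def deltaDIneq {ι κ : Type*} [Fintype ι] [Fintype κ]
    (A : Matrix ι κ ℝ) (b : ι → ℝ) (c : κ → ℝ) : ℝ := distDualIneq A b c / dnorm A b c

/-- Constraint matrix of the vertex-cover LP in inequality form `Ax ≥ b, x ≥ 0`:
one row `e_uᵀ + e_vᵀ` per edge and one row `−e_vᵀ` per vertex. -/
noncomputable def vcMat {n m : ℕ} (E : Fin m → Fin n × Fin n) :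
    Matrix (Fin m ⊕ Fin n) (Fin n) ℝ :=
  Matrix.of (Sum.elim
    (fun e w => (if w = (E e).1 then (1 : ℝ) else 0) + (if w = (E e).2 then (1 : ℝ) else 0))
    (fun v w => if w = v then (-1 : ℝ) else 0))

/-- Right-hand side of the vertex-cover LP in inequality form: `1` for edge rows,
`−1` for the rows encoding `x_v ≤ 1`. -/
noncomputable def vcRhs (n m : ℕ) : Fin m ⊕ Fin n → ℝ :=
  Sum.elim (fun _ => (1 : ℝ)) (fun _ => (-1 : ℝ))

theorem abs_apply_le_l2norm {ι : Type*} [Fintype ι] (x : ι → ℝ) (i : ι) :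
    |x i| ≤ l2norm x := by
  refine Real.abs_le_sqrt ?_
  exact Finset.single_le_sum (f := fun j => (x j) ^ 2) (fun j _ => sq_nonneg _)
    (Finset.mem_univ i)

theorem abs_sum_row_le_sqrt_card_mul_frobNorm {ι κ : Type*} [Fintype ι] [Fintype κ]
    (A : Matrix ι κ ℝ) (i : ι) :
    |∑ j, A i j| ≤ Real.sqrt (Fintype.card κ) * frobNorm A := by
  rw [frobNorm, ← Real.sqrt_mul (Nat.cast_nonneg _)]
  refine Real.abs_le_sqrt (le_trans sq_sum_le_card_mul_sum_sq ?_)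
  rw [Finset.card_univ]
  refine mul_le_mul_of_nonneg_left ?_ (Nat.cast_nonneg _)
  exact Finset.single_le_sum (f := fun k => ∑ j, (A k j) ^ 2)
    (fun k _ => Finset.sum_nonneg fun j _ => sq_nonneg _) (Finset.mem_univ i)

theorem le_distPriIneq {ι κ : Type*} [Fintype ι] [Fintype κ] [Nonempty ι]
    (A : Matrix ι κ ℝ) (b : ι → ℝ) (c : κ → ℝ) {r : ℝ}
    (h : ∀ dA db dc, dnorm dA db dc < r → PrimalFeasibleIneq (A + dA) (b + db)) :
    r ≤ distPriIneq A b c := by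
  refine le_csInf ⟨_, -A, 1 - b, 0, ?_, rfl⟩ ?_
  · rintro ⟨x, -, hx⟩
    have := hx (Classical.arbitrary ι)
    simp only [add_neg_cancel, Matrix.zero_mulVec, add_sub_cancel, Pi.zero_apply,
      Pi.one_apply] at this
    linarith
  · rintro _ ⟨dA, db, dc, hinf, rfl⟩
    by_contra! hlt
    exact hinf (h dA db dc hlt)

theorem le_distDualIneq {ι κ : Type*} [Fintype ι] [Fintype κ] [Nonempty κ]
    (A : Matrix ι κ ℝ) (b : ι → ℝ) (c : κ → ℝ) {r : ℝ}
    (h : ∀ dA db dc, dnorm dA db dc < r → DualFeasibleIneq (A + dA) (c + dc)) :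
    r ≤ distDualIneq A b c := by
  refine le_csInf ⟨_, -A, 0, -1 - c, ?_, rfl⟩ ?_
  · rintro ⟨y, -, hy⟩
    have := hy (Classical.arbitrary κ)
    simp only [add_neg_cancel, Matrix.transpose_zero, Matrix.zero_mulVec, add_sub_cancel,
      Pi.zero_apply, Pi.neg_apply, Pi.one_apply] at this
    linarith
  · rintro _ ⟨dA, db, dc, hinf, rfl⟩
    by_contra! hlt
    exact hinf (h dA db dc hlt)

/-- If `c ≥ 1` entrywise then `y = 0` stays dual feasible under perturbations of norm below `1`. -/
theorem one_le_distDualIneq {ι κ : Type*} [Fintype ι] [Fintype κ] [Nonempty κ]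
    (A : Matrix ι κ ℝ) (b : ι → ℝ) (c : κ → ℝ) (hc : ∀ j, 1 ≤ c j) :
    1 ≤ distDualIneq A b c := by
  refine le_distDualIneq A b c fun dA db dc hd => ⟨0, fun _ => le_rfl, fun j => ?_⟩
  have hdc : l2norm dc < 1 := ((le_max_right _ _).trans (le_max_right _ _)).trans_lt hd
  have := abs_le.1 (abs_apply_le_l2norm dc j)
  have := hc j
  simp only [Matrix.mulVec_zero, Pi.zero_apply, Pi.add_apply]
  linarith

theorem sum_vcMat_inl {n m : ℕ} (E : Fin m → Fin n × Fin n) (e : Fin m) :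
    ∑ j, vcMat E (Sum.inl e) j = 2 := by
  simp [vcMat, Finset.sum_add_distrib]
  norm_num

theorem sum_vcMat_inr {n m : ℕ} (E : Fin m → Fin n × Fin n) (v : Fin n) :
    ∑ j, vcMat E (Sum.inr v) j = -1 := by
  simp [vcMat]

theorem sum_sq_vcMat_inl {n m : ℕ} (E : Fin m → Fin n × Fin n) (e : Fin m)
    (he : (E e).1 ≠ (E e).2) : ∑ j, vcMat E (Sum.inl e) j ^ 2 = 2 := by
  rw [← sum_vcMat_inl E e]
  refine Finset.sum_congr rfl fun j _ => ?_
  simp only [vcMat, Matrix.of_apply, Sum.elim_inl]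
  split_ifs with h₁ h₂
  · exact absurd (h₁.symm.trans h₂) he
  all_goals norm_num

theorem sum_sq_vcMat_inr {n m : ℕ} (E : Fin m → Fin n × Fin n) (v : Fin n) :
    ∑ j, vcMat E (Sum.inr v) j ^ 2 = 1 := by
  simp [vcMat]

theorem frobNorm_vcMat {n m : ℕ} (E : Fin m → Fin n × Fin n) (hE : ∀ e, (E e).1 ≠ (E e).2) :
    frobNorm (vcMat E) = Real.sqrt (2 * m + n) := by
  rw [frobNorm, Fintype.sum_sum_type]
  simp only [sum_sq_vcMat_inl E _ (hE _), sum_sq_vcMat_inr]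
  simp [mul_comm]

theorem dnorm_vcMat {n m : ℕ} (E : Fin m → Fin n × Fin n) (hE : ∀ e, (E e).1 ≠ (E e).2) :
    dnorm (vcMat E) (vcRhs n m) (fun _ => (1 : ℝ)) = Real.sqrt (2 * m + n) := by
  have hm : (0 : ℝ) ≤ m := Nat.cast_nonneg m
  have hb : l2norm (vcRhs n m) = Real.sqrt (m + n) := by
    simp [l2norm, vcRhs, Fintype.sum_sum_type]
  have hc : l2norm (fun _ : Fin n => (1 : ℝ)) = Real.sqrt n := by simp [l2norm]
  rw [dnorm, frobNorm_vcMat E hE, hb, hc]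
  refine max_eq_left (max_le ?_ ?_) <;> refine Real.sqrt_le_sqrt ?_ <;> linarith

/-- The point with all coordinates `2/3` has slack `1/3` in every constraint, so it stays
feasible under small perturbations. -/
theorem inv_sqrt_div_four_le_distPriIneq_vcMat {n m : ℕ} (hn : 3 ≤ n)
    (E : Fin m → Fin n × Fin n) (c : Fin n → ℝ) :
    (Real.sqrt n)⁻¹ / 4 ≤ distPriIneq (vcMat E) (vcRhs n m) c := by
  have : Nonempty (Fin n) := ⟨⟨0, by lia⟩⟩
  have hn' : (3 : ℝ) ≤ n := by exact_mod_cast hn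
  have hs : (3 / 2 : ℝ) ≤ Real.sqrt n := Real.le_sqrt_of_sq_le (by linarith)
  have hs0 : 0 < Real.sqrt n := by linarith
  refine le_distPriIneq _ _ c fun dA db dc hd =>
    ⟨fun _ => 2 / 3, fun _ => by norm_num, fun i => ?_⟩
  have hdA : frobNorm dA < (Real.sqrt n)⁻¹ / 4 := (le_max_left _ _).trans_lt hd
  have hdb : l2norm db < (Real.sqrt n)⁻¹ / 4 :=
    ((le_max_left _ _).trans (le_max_right _ _)).trans_lt hd
  have hinv : (Real.sqrt n)⁻¹ ≤ 2 / 3 := by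
    rw [inv_le_comm₀ hs0 (by norm_num)]
    linarith
  have hrow : |∑ j, dA i j| ≤ 1 / 4 := by
    calc |∑ j, dA i j| ≤ Real.sqrt n * frobNorm dA := by
          simpa using abs_sum_row_le_sqrt_card_mul_frobNorm dA i
      _ ≤ Real.sqrt n * ((Real.sqrt n)⁻¹ / 4) := by gcongr
      _ = 1 / 4 := by field_simp
  have hrow' := abs_le.1 hrow
  have hdb' := abs_le.1 (abs_apply_le_l2norm db i)
  have hsplit : (vcMat E + dA).mulVec (fun _ => (2 / 3 : ℝ)) i
      = (∑ j, vcMat E i j + ∑ j, dA i j) * (2 / 3) := by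
    simp only [Matrix.mulVec, dotProduct, Matrix.add_apply]
    rw [← Finset.sum_mul, Finset.sum_add_distrib]
  rw [hsplit, Pi.add_apply]
  rcases i with e | v
  · rw [sum_vcMat_inl]
    simp only [vcRhs, Sum.elim_inl]
    linarith
  · rw [sum_vcMat_inr]
    simp only [vcRhs, Sum.elim_inr]
    linarith

/-- conditioning of the vertex-cover LP. With `‖d‖ = √(2m+n)`,
`δ_P ≥ ‖d‖⁻¹ n^{-1/2}/4` and `δ_D ≥ ‖d‖⁻¹`, so
`1/(δ_P δ_D) ≤ 4(2m+n)√n = O((m+n)√n)`. -/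
theorem vertex_cover_condition_number_product
    (n m : ℕ) (hn : 3 ≤ n)
    (E : Fin m → Fin n × Fin n) (hE : ∀ e, (E e).1 ≠ (E e).2)
    (A : Matrix (Fin m ⊕ Fin n) (Fin n) ℝ) (hA : A = vcMat E)
    (b : Fin m ⊕ Fin n → ℝ) (hb : b = vcRhs n m)
    (c : Fin n → ℝ) (hc : c = fun _ => (1 : ℝ)) :
    dnorm A b c = Real.sqrt (2 * m + n) ∧
    (dnorm A b c)⁻¹ * (Real.sqrt n)⁻¹ / 4 ≤ deltaPIneq A b c ∧
    (dnorm A b c)⁻¹ ≤ deltaDIneq A b c ∧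
    1 / (deltaPIneq A b c * deltaDIneq A b c) ≤
      4 * (2 * m + n) * Real.sqrt n := by
  subst hA hb hc
  have : Nonempty (Fin n) := ⟨⟨0, by lia⟩⟩
  have hn0 : (0 : ℝ) < n := by exact_mod_cast (show 0 < n by lia)
  have hpos : (0 : ℝ) < 2 * m + n := by positivity
  have hd := dnorm_vcMat E hE
  have hP := inv_sqrt_div_four_le_distPriIneq_vcMat hn E (fun _ => (1 : ℝ))
  have hD := one_le_distDualIneq (vcMat E) (vcRhs n m) (fun _ => (1 : ℝ)) fun _ => le_rfl
  have hD0 : 0 < dnorm (vcMat E) (vcRhs n m) (fun _ => (1 : ℝ)) := by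
    rw [hd]
    exact Real.sqrt_pos.2 hpos
  have hsq : dnorm (vcMat E) (vcRhs n m) (fun _ => (1 : ℝ)) ^ 2 = 2 * m + n := by
    rw [hd, Real.sq_sqrt hpos.le]
  unfold deltaPIneq deltaDIneq
  generalize dnorm (vcMat E) (vcRhs n m) (fun _ => (1 : ℝ)) = D at *
  generalize distPriIneq (vcMat E) (vcRhs n m) (fun _ => (1 : ℝ)) = p at *
  generalize distDualIneq (vcMat E) (vcRhs n m) (fun _ => (1 : ℝ)) = q at *
  have hs0 : 0 < Real.sqrt n := Real.sqrt_pos.2 hn0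
  have hP' : D⁻¹ * (Real.sqrt n)⁻¹ / 4 ≤ p / D := by
    rw [mul_div_assoc, mul_comm, ← div_eq_mul_inv]
    gcongr
  have hD' : D⁻¹ ≤ q / D := by
    rw [inv_eq_one_div]
    gcongr
  have hp0 : 0 ≤ p / D := le_trans (by positivity) hP'
  refine ⟨hd, hP', hD', ?_⟩
  calc 1 / (p / D * (q / D)) ≤ 1 / (D⁻¹ * (Real.sqrt n)⁻¹ / 4 * D⁻¹) := by gcongr
    _ = 4 * D ^ 2 * Real.sqrt n := by field_simp
    _ = 4 * (2 * m + n) * Real.sqrt n := by rw [hsq]
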